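/- arXiv:1510.04717 — 8 statements merged into one kernel-verified Lean document; each statement's English description precedes it below -/
import Mathlib

section
/- Let p₀,p₁,p₂,p₃,p₄ be real numbers with p₄ ≠ 0 and let P(x) = p₄x⁴ + p₃x³ + p₂x² + p₁x + p₀. If disc(P) < 0, then the multiset of complex roots of P (counted with multiplicity) consists of two distinct real numbers and a pair {z, conj(z)} with z non-real; in particular P has exactly two real roots, both simple. -/
open Polynomial

/-- Every real quartic is its leading coefficient times a product of two real monic quadratics. -/
lemma exists_quadratic_factorization (p₀ p₁ p₂ p₃ p₄ : ℝ) (hp₄ : p₄ ≠ 0) :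
    ∃ a b c d : ℝ, p₃ = p₄ * (a + c) ∧ p₂ = p₄ * (b + a * c + d) ∧
      p₁ = p₄ * (a * d + b * c) ∧ p₀ = p₄ * (b * d) := by
  have hmonic : IsMonicOfDegree
      (X ^ 4 + C (p₃ / p₄) * X ^ 3 + C (p₂ / p₄) * X ^ 2 + C (p₁ / p₄) * X + C (p₀ / p₄))
      (2 + 2) := by
    rw [isMonicOfDegree_iff]
    constructor
    · compute_degree
    · compute_degree!
  obtain ⟨f, g, hf, hg, hfg⟩ := hmonic.eq_isMonicOfDegree_two_mul_isMonicOfDegree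
  obtain ⟨a, b, rfl⟩ := isMonicOfDegree_two_iff.mp hf
  obtain ⟨c, d, rfl⟩ := isMonicOfDegree_two_iff.mp hg
  have hexpand : (X ^ 2 + C a * X + C b) * (X ^ 2 + C c * X + C d) =
      X ^ 4 + C (a + c) * X ^ 3 + C (b + a * c + d) * X ^ 2 + C (a * d + b * c) * X
        + C (b * d) := by
    simp only [map_add, map_mul]
    ring
  rw [hexpand] at hfg
  have h₀ := congrArg (coeff · 0) hfg
  have h₁ := congrArg (coeff · 1) hfg
  have h₂ := congrArg (coeff · 2) hfg
  have h₃ := congrArg (coeff · 3) hfg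
  simp [coeff_X, coeff_C, coeff_X_pow, -map_add, -map_mul] at h₀ h₁ h₂ h₃
  refine ⟨a, b, c, d, ?_, ?_, ?_, ?_⟩
  · rw [← h₃]; field_simp
  · rw [← h₂]; field_simp
  · rw [← h₁]; field_simp
  · rw [← h₀]; field_simp

/-- The roots of a product of two real quadratics, the first with positive and the second with
negative discriminant. -/
lemma roots_mul_quadratics {p a b c d : ℝ} (hp : p ≠ 0) (hab : 0 < a ^ 2 - 4 * b)
    (hcd : c ^ 2 - 4 * d < 0) :
    ∃ (x₁ x₂ : ℝ) (z : ℂ), x₁ ≠ x₂ ∧ z.im ≠ 0 ∧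
      (C (p : ℂ) * ((X ^ 2 + C (a : ℂ) * X + C (b : ℂ)) *
        (X ^ 2 + C (c : ℂ) * X + C (d : ℂ)))).roots
        = {(x₁ : ℂ), (x₂ : ℂ), z, (starRingEnd ℂ) z} := by
  obtain ⟨s, hs, hs_sq⟩ : ∃ s : ℝ, 0 < s ∧ s ^ 2 = a ^ 2 - 4 * b :=
    ⟨_, Real.sqrt_pos.mpr hab, Real.sq_sqrt hab.le⟩
  obtain ⟨t, ht, ht_sq⟩ : ∃ t : ℝ, 0 < t ∧ t ^ 2 = 4 * d - c ^ 2 :=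
    ⟨_, Real.sqrt_pos.mpr (by linarith), Real.sq_sqrt (by linarith)⟩
  obtain rfl : b = (-a + s) / 2 * ((-a - s) / 2) := by linear_combination hs_sq / 4
  obtain rfl : d = (c ^ 2 + t ^ 2) / 4 := by linear_combination - ht_sq / 4
  set x₁ := (-a + s) / 2 with hx₁
  set x₂ := (-a - s) / 2 with hx₂
  have hfst : (X ^ 2 + C (a : ℂ) * X + C ((x₁ * x₂ : ℝ) : ℂ))
      = (X - C (x₁ : ℂ)) * (X - C (x₂ : ℂ)) := by
    have ha : a = -(x₁ + x₂) := by rw [hx₁, hx₂]; ring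
    rw [ha]
    push_cast
    simp only [map_neg, map_add, map_mul]
    ring
  set z : ℂ := ⟨-c / 2, t / 2⟩ with hz
  have hadd : (c : ℂ) = -(z + (starRingEnd ℂ) z) := by
    apply Complex.ext
    · simp [hz]
      ring
    · simp [hz]
  have hmul : (((c ^ 2 + t ^ 2) / 4 : ℝ) : ℂ) = z * (starRingEnd ℂ) z := by
    rw [Complex.mul_conj, Complex.normSq_mk]
    congr 1
    ring
  have hsnd : (X ^ 2 + C (c : ℂ) * X + C (((c ^ 2 + t ^ 2) / 4 : ℝ) : ℂ))
      = (X - C z) * (X - C ((starRingEnd ℂ) z)) := by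
    rw [hmul, hadd]
    simp only [map_neg, map_add, map_mul]
    ring
  refine ⟨x₁, x₂, z, by linarith, by simp [hz, ht.ne'], ?_⟩
  rw [roots_C_mul _ (Complex.ofReal_ne_zero.mpr hp), hfst, hsnd]
  convert roots_multiset_prod_X_sub_C
    ({(x₁ : ℂ), (x₂ : ℂ), z, (starRingEnd ℂ) z} : Multiset ℂ) using 2
  simp [mul_assoc]

/-- If the discriminant of a real quartic is negative, then its complex
roots (with multiplicity) consist of two distinct real numbers and a non-real conjugate
pair; in particular it has exactly two real roots, both simple. -/
theorem quartic_disc_neg_roots (p₀ p₁ p₂ p₃ p₄ : ℝ) (hp₄ : p₄ ≠ 0)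
    (hdisc : 256*p₄^3*p₀^3 - 192*p₄^2*p₃*p₁*p₀^2 - 128*p₄^2*p₂^2*p₀^2
      + 144*p₄^2*p₂*p₁^2*p₀ - 27*p₄^2*p₁^4 + 144*p₄*p₃^2*p₂*p₀^2
      - 6*p₄*p₃^2*p₁^2*p₀ - 80*p₄*p₃*p₂^2*p₁*p₀ + 18*p₄*p₃*p₂*p₁^3
      + 16*p₄*p₂^4*p₀ - 4*p₄*p₂^3*p₁^2 - 27*p₃^4*p₀^2 + 18*p₃^3*p₂*p₁*p₀
      - 4*p₃^3*p₁^3 - 4*p₃^2*p₂^3*p₀ + p₃^2*p₂^2*p₁^2 < 0) :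
    ∃ (x₁ x₂ : ℝ) (z : ℂ), x₁ ≠ x₂ ∧ z.im ≠ 0 ∧
      (C (p₄:ℂ) * X^4 + C (p₃:ℂ) * X^3 + C (p₂:ℂ) * X^2 + C (p₁:ℂ) * X + C (p₀:ℂ)).roots
        = {(x₁:ℂ), (x₂:ℂ), z, (starRingEnd ℂ) z} := by
  obtain ⟨a, b, c, d, rfl, rfl, rfl, rfl⟩ := exists_quadratic_factorization p₀ p₁ p₂ p₃ p₄ hp₄
  have hneg : (p₄ ^ 3 * ((b - d) ^ 2 + (a - c) * (a * d - b * c))) ^ 2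
      * ((a ^ 2 - 4 * b) * (c ^ 2 - 4 * d)) < 0 := by
    convert hdisc using 1
    ring
  have hprod := neg_of_mul_neg_right hneg (sq_nonneg _)
  have hfactor : C (p₄ : ℂ) * X ^ 4 + C ((p₄ * (a + c) : ℝ) : ℂ) * X ^ 3
      + C ((p₄ * (b + a * c + d) : ℝ) : ℂ) * X ^ 2 + C ((p₄ * (a * d + b * c) : ℝ) : ℂ) * X
      + C ((p₄ * (b * d) : ℝ) : ℂ)
      = C (p₄ : ℂ) * ((X ^ 2 + C (a : ℂ) * X + C (b : ℂ)) *
        (X ^ 2 + C (c : ℂ) * X + C (d : ℂ))) := by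
    push_cast
    simp only [map_add, map_mul]
    ring
  rw [hfactor]
  rcases mul_neg_iff.mp hprod with ⟨hab, hcd⟩ | ⟨hab, hcd⟩
  · exact roots_mul_quadratics hp₄ hab hcd
  · rw [mul_comm (X ^ 2 + C (a : ℂ) * X + C (b : ℂ))]
    exact roots_mul_quadratics hp₄ hcd hab
end

section
/- Let p₀,p₁,p₂,p₃,p₄ be real numbers with p₄ ≠ 0 and let P(x) = p₄x⁴ + p₃x³ + p₂x² + p₁x + p₀. If disc(P) > 0, disc₁(P) < 0 and disc₂(P) < 0, then P has four distinct real roots. -/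
open Polynomial

/-- A real polynomial of degree at least two has a monic quadratic divisor. -/
theorem exists_quadratic_dvd (P : ℝ[X]) (hP : 2 ≤ P.natDegree) :
    ∃ u v : ℝ, X ^ 2 + C u * X + C v ∣ P := by
  have root_or_dvd : ∀ Q : ℝ[X], 1 ≤ Q.natDegree →
      (∃ x : ℝ, X - C x ∣ Q) ∨ ∃ u v : ℝ, X ^ 2 + C u * X + C v ∣ Q := by
    intro Q hQ
    obtain ⟨z, hz⟩ := IsAlgClosed.exists_aeval_eq_zero ℂ Q
      (natDegree_pos_iff_degree_pos.1 hQ).ne'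
    by_cases him : z.im = 0
    · left
      refine ⟨z.re, dvd_iff_isRoot.2 ?_⟩
      have hzr : z = algebraMap ℝ ℂ z.re := Complex.ext (by simp) (by simpa using him)
      rw [hzr, aeval_algebraMap_apply] at hz
      simpa using hz
    · right
      refine ⟨-(2 * z.re), ‖z‖ ^ 2, ?_⟩
      have h := Q.quadratic_dvd_of_aeval_eq_zero_im_ne_zero hz him
      simpa [sub_eq_add_neg] using h
  rcases root_or_dvd P (by omega) with ⟨x, Q, hQ⟩ | h
  · have hQ0 : Q ≠ 0 := by
      rintro rfl
      simp [hQ] at hP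
    have hdeg : P.natDegree = 1 + Q.natDegree := by
      rw [hQ, natDegree_mul (X_sub_C_ne_zero x) hQ0, natDegree_X_sub_C]
    rcases root_or_dvd Q (by omega) with ⟨y, hy⟩ | ⟨u, v, h⟩
    · refine ⟨-(x + y), x * y, ?_⟩
      have hfac : X ^ 2 + C (-(x + y)) * X + C (x * y) = (X - C x) * (X - C y) := by
        simp only [map_neg, map_add, map_mul]
        ring
      rw [hfac, hQ]
      exact mul_dvd_mul_left _ hy
    · exact ⟨u, v, hQ ▸ h.mul_left _⟩
  · exact h

/-- Every real quartic is the product of two real quadratics. -/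
theorem exists_quadratic_mul_quadratic (p₀ p₁ p₂ p₃ p₄ : ℝ) (hp₄ : p₄ ≠ 0) :
    ∃ u v b c : ℝ, p₃ = b + u * p₄ ∧ p₂ = c + u * b + v * p₄ ∧ p₁ = u * c + v * b ∧
      p₀ = v * c := by
  have hdeg : (C p₄ * X ^ 4 + C p₃ * X ^ 3 + C p₂ * X ^ 2 + C p₁ * X + C p₀).natDegree = 4 := by
    compute_degree!
  obtain ⟨u, v, Q, hQ⟩ := exists_quadratic_dvd _ (le_of_le_of_eq (by norm_num) hdeg.symm)
  have hmonic : (X ^ 2 + C u * X + C v).Monic := by monicity!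
  have hquad : (X ^ 2 + C u * X + C v).natDegree = 2 := by compute_degree!
  have hQ0 : Q ≠ 0 := by
    rintro rfl
    simp [hQ] at hdeg
  have hQdeg : Q.natDegree = 2 := by
    rw [hQ, hmonic.natDegree_mul' hQ0, hquad] at hdeg
    omega
  have hQform := eq_quadratic_of_degree_le_two (natDegree_le_iff_degree_le.1 hQdeg.le)
  generalize Q.coeff 2 = a at hQform
  generalize Q.coeff 1 = b at hQform
  generalize Q.coeff 0 = c at hQform
  have hprod : (X ^ 2 + C u * X + C v) * Q = C a * X ^ 4 + C (b + u * a) * X ^ 3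
      + C (c + u * b + v * a) * X ^ 2 + C (u * c + v * b) * X + C (v * c) := by
    rw [hQform]
    simp only [map_add, map_mul]
    ring
  rw [hprod] at hQ
  have h (n : ℕ) := congrArg (coeff · n) hQ
  have h₀ := h 0
  have h₁ := h 1
  have h₂ := h 2
  have h₃ := h 3
  have h₄ := h 4
  simp [coeff_X, coeff_C, -map_add, -map_mul] at h₀ h₁ h₂ h₃ h₄
  subst h₄
  exact ⟨u, v, b, c, h₃, h₂, h₁, h₀⟩

/-- A real quadratic with nonnegative discriminant splits. -/
theorem exists_eq_mul_add_of_discrim_nonneg {a b c : ℝ} (ha : a ≠ 0)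
    (h : 0 ≤ b ^ 2 - 4 * a * c) : ∃ x y : ℝ, b = -(a * (x + y)) ∧ c = a * (x * y) := by
  obtain ⟨s, hs⟩ : ∃ s, s ^ 2 = b ^ 2 - 4 * a * c := ⟨_, Real.sq_sqrt h⟩
  refine ⟨(-b + s) / (2 * a), (-b - s) / (2 * a), ?_, ?_⟩
  · field_simp
    ring
  · field_simp
    linear_combination hs

/-- If disc(P) > 0, disc₁(P) < 0 and disc₂(P) < 0, then the real quartic
P has four distinct real roots. -/
theorem quartic_disc_pos_four_real_roots (p₀ p₁ p₂ p₃ p₄ : ℝ) (hp₄ : p₄ ≠ 0)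
    (hdisc : 0 < 256*p₄^3*p₀^3 - 192*p₄^2*p₃*p₁*p₀^2 - 128*p₄^2*p₂^2*p₀^2
      + 144*p₄^2*p₂*p₁^2*p₀ - 27*p₄^2*p₁^4 + 144*p₄*p₃^2*p₂*p₀^2
      - 6*p₄*p₃^2*p₁^2*p₀ - 80*p₄*p₃*p₂^2*p₁*p₀ + 18*p₄*p₃*p₂*p₁^3
      + 16*p₄*p₂^4*p₀ - 4*p₄*p₂^3*p₁^2 - 27*p₃^4*p₀^2 + 18*p₃^3*p₂*p₁*p₀
      - 4*p₃^3*p₁^3 - 4*p₃^2*p₂^3*p₀ + p₃^2*p₂^2*p₁^2)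
    (hdisc1 : 8*p₄*p₂ - 3*p₃^2 < 0)
    (hdisc2 : 64*p₄^3*p₀ - 16*p₄^2*p₂^2 + 16*p₄*p₃^2*p₂ - 16*p₄^2*p₃*p₁ - 3*p₃^4 < 0) :
    ∃ x₁ x₂ x₃ x₄ : ℝ, x₁ ≠ x₂ ∧ x₁ ≠ x₃ ∧ x₁ ≠ x₄ ∧ x₂ ≠ x₃ ∧ x₂ ≠ x₄ ∧ x₃ ≠ x₄ ∧
      (C (p₄:ℂ) * X^4 + C (p₃:ℂ) * X^3 + C (p₂:ℂ) * X^2 + C (p₁:ℂ) * X + C (p₀:ℂ)).roots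
        = {(x₁:ℂ), (x₂:ℂ), (x₃:ℂ), (x₄:ℂ)} := by
  obtain ⟨u, v, b, c, rfl, rfl, rfl, rfl⟩ := exists_quadratic_mul_quadratic p₀ p₁ p₂ p₃ p₄ hp₄
  have hmul : 0 < (u ^ 2 - 4 * 1 * v) * (b ^ 2 - 4 * p₄ * c) := by
    refine pos_of_mul_pos_left (b := ((c - p₄ * v) ^ 2 - (b - p₄ * u) * (u * c - b * v)) ^ 2)
      (lt_of_lt_of_eq hdisc ?_) (sq_nonneg _)
    ring
  rcases mul_pos_iff.1 hmul with ⟨hD, hE⟩ | ⟨hD, hE⟩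
  · obtain ⟨x₁, x₂, hu, hv⟩ := exists_eq_mul_add_of_discrim_nonneg one_ne_zero hD.le
    obtain ⟨x₃, x₄, hb, hc⟩ := exists_eq_mul_add_of_discrim_nonneg hp₄ hE.le
    subst hu hv hb hc
    refine ⟨x₁, x₂, x₃, x₄, ?_, ?_, ?_, ?_, ?_, ?_, ?_⟩
    iterate 6
      rintro rfl
      refine hdisc.ne' ?_
      ring
    have hfac : C (p₄ : ℂ) * X ^ 4 + C ((-(p₄ * (x₃ + x₄)) + -(1 * (x₁ + x₂)) * p₄ : ℝ) : ℂ) * X ^ 3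
        + C ((p₄ * (x₃ * x₄) + -(1 * (x₁ + x₂)) * -(p₄ * (x₃ + x₄)) + 1 * (x₁ * x₂) * p₄ : ℝ) : ℂ)
          * X ^ 2
        + C ((-(1 * (x₁ + x₂)) * (p₄ * (x₃ * x₄)) + 1 * (x₁ * x₂) * -(p₄ * (x₃ + x₄)) : ℝ) : ℂ) * X
        + C ((1 * (x₁ * x₂) * (p₄ * (x₃ * x₄)) : ℝ) : ℂ)
        = C (p₄ : ℂ) * (({(x₁ : ℂ), (x₂ : ℂ), (x₃ : ℂ), (x₄ : ℂ)} : Multiset ℂ).map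
          (fun z ↦ X - C z)).prod := by
      simp
      ring
    rw [hfac, roots_C_mul _ (Complex.ofReal_ne_zero.2 hp₄), roots_multiset_prod_X_sub_C]
  · -- Two nonreal conjugate pairs: `m`, `n` scale the squared imaginary parts,
    -- and `t` the squared difference of the real parts.
    exfalso
    have ha : 0 < p₄ ^ 2 := by positivity
    set m := p₄ ^ 2 * (4 * v - u ^ 2) with hm
    set n := 4 * p₄ * c - b ^ 2 with hn
    set t := (p₄ * u - b) ^ 2 with ht
    have hm0 : 0 < m := mul_pos ha (by linarith)
    have hn0 : 0 < n := by linarith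
    have h₁ : 2 * (m + n) < t := by
      linear_combination hdisc1
    have h₂ : 2 * t * (m + n) < (m - n) ^ 2 := by
      linear_combination hdisc2
    nlinarith [mul_pos hm0 hn0, mul_lt_mul_of_pos_right h₁ (add_pos hm0 hn0)]
end

section
/- Let m(k) = 1/(1+k²) and define the modulational instability index ind_BBM(k) := i₁(k)·i₂⁻(k)·i_BBM(k)/i₃⁻(k). Then for every k > 0: ind_BBM(k) < 0 if and only if k > √3, and ind_BBM(k) > 0 if and only if 0 < k < √3. -/
/-- The BBM dispersion symbol `m(k) = 1/(1+k²)`. -/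
noncomputable def mBBM (k : ℝ) : ℝ := 1 / (1 + k^2)

/-- `i₁(k)`, the second derivative of `k ↦ k·m(k)`. -/
noncomputable def i1BBM (k : ℝ) : ℝ := deriv (deriv (fun x : ℝ => x * mBBM x)) k

/-- `i₂⁻(k)`, the derivative of `k ↦ k·m(k)` minus one. -/
noncomputable def i2mBBM (k : ℝ) : ℝ := deriv (fun x : ℝ => x * mBBM x) k - 1

/-- `i₃⁻(k) = m(k) − m(2k)`. -/
noncomputable def i3mBBM (k : ℝ) : ℝ := mBBM k - mBBM (2*k)

/-- `i_BBM(k) = 2 i₃⁻(k) + m(2k) i₂⁻(k)`. -/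
noncomputable def iBBM (k : ℝ) : ℝ := 2 * i3mBBM k + mBBM (2*k) * i2mBBM k

/-- The modulational instability index for the BBM equation. -/
noncomputable def indBBM (k : ℝ) : ℝ := i1BBM k * i2mBBM k * iBBM k / i3mBBM k

theorem deriv_mul_mBBM :
    deriv (fun x : ℝ => x * mBBM x) = fun x => (1 - x ^ 2) / (1 + x ^ 2) ^ 2 := by
  funext x
  have hx : 1 + x ^ 2 ≠ 0 := by positivity
  have h := (hasDerivAt_id' x).mul
    ((hasDerivAt_const x (1 : ℝ)).div ((hasDerivAt_pow 2 x).const_add 1) hx)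
  refine (h.congr_deriv ?_).deriv
  simp only [Pi.div_apply]
  field_simp
  push_cast
  ring

theorem i1BBM_eq (k : ℝ) : i1BBM k = 2 * k * (k ^ 2 - 3) / (1 + k ^ 2) ^ 3 := by
  have hk : 1 + k ^ 2 ≠ 0 := by positivity
  rw [i1BBM, deriv_mul_mBBM]
  have h := ((hasDerivAt_pow 2 k).const_sub 1).div
    (((hasDerivAt_pow 2 k).const_add 1).pow 2) (pow_ne_zero 2 hk)
  refine (h.congr_deriv ?_).deriv
  simp only [Pi.pow_apply]
  field_simp
  push_cast
  ring

theorem i2mBBM_eq (k : ℝ) : i2mBBM k = -(k ^ 2 * (3 + k ^ 2)) / (1 + k ^ 2) ^ 2 := by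
  have hk : 1 + k ^ 2 ≠ 0 := by positivity
  rw [i2mBBM, deriv_mul_mBBM]
  field_simp
  ring

theorem i3mBBM_eq (k : ℝ) :
    i3mBBM k = 3 * k ^ 2 / ((1 + k ^ 2) * (1 + (2 * k) ^ 2)) := by
  have hk : 1 + k ^ 2 ≠ 0 := by positivity
  have hk' : 1 + (2 * k) ^ 2 ≠ 0 := by positivity
  rw [i3mBBM, mBBM, mBBM, div_sub_div _ _ hk hk']
  congr 1
  ring

theorem iBBM_eq (k : ℝ) :
    iBBM k = k ^ 2 * (3 + 5 * k ^ 2) / ((1 + k ^ 2) ^ 2 * (1 + (2 * k) ^ 2)) := by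
  have hk : 1 + k ^ 2 ≠ 0 := by positivity
  have hk' : 1 + (2 * k) ^ 2 ≠ 0 := by positivity
  rw [iBBM, i3mBBM_eq, i2mBBM_eq, mBBM]
  generalize 1 + (2 * k) ^ 2 = d at hk' ⊢
  field_simp
  ring

theorem indBBM_eq {k : ℝ} (hk : k ≠ 0) :
    indBBM k = (3 - k ^ 2) *
      (2 * k ^ 3 * (3 + k ^ 2) * (3 + 5 * k ^ 2) / (3 * (1 + k ^ 2) ^ 6)) := by
  have hk₁ : 1 + k ^ 2 ≠ 0 := by positivity
  have hk₂ : 1 + (2 * k) ^ 2 ≠ 0 := by positivity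
  rw [indBBM, i1BBM_eq, i2mBBM_eq, iBBM_eq, i3mBBM_eq]
  generalize 1 + (2 * k) ^ 2 = d at hk₂ ⊢
  field_simp
  ring

/-- For the BBM equation, `ind_BBM(k) < 0` iff `k > √3` and
`ind_BBM(k) > 0` iff `0 < k < √3`, for every `k > 0`. -/
theorem indBBM_sign (k : ℝ) (hk : 0 < k) :
    (indBBM k < 0 ↔ Real.sqrt 3 < k) ∧
    (0 < indBBM k ↔ (0 < k ∧ k < Real.sqrt 3)) := by
  have hpos : 0 < 2 * k ^ 3 * (3 + k ^ 2) * (3 + 5 * k ^ 2) / (3 * (1 + k ^ 2) ^ 6) := by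
    positivity
  rw [indBBM_eq hk.ne', mul_pos_iff_of_pos_right hpos, ← neg_pos, ← neg_mul,
    mul_pos_iff_of_pos_right hpos, neg_pos, sub_neg, sub_pos, Real.sqrt_lt' hk,
    Real.lt_sqrt hk.le]
  exact ⟨Iff.rfl, (and_iff_right hk).symm⟩
end

section
/- Let m(k) = 1/(1+k²) and, for k > 0, ξ ∈ ℝ and n ∈ ℤ, set ω_{n,ξ} := (ξ+n)·(m(k) − m(k(ξ+n))). Then for every k > 0 and every ξ with 0 < ξ ≤ 1/2: ω_{n,ξ} > 0 for every integer n ≥ 1, ω_{n,ξ} < 0 for every integer n ≤ −2, ω_{0,ξ} < 0, ω_{−1,ξ} > 0, and moreover ω_{n,ξ} < ω_{n+1,ξ} whenever n ≥ 1 or n ≤ −3. -/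
/-- `ω_{n,ξ} = (ξ+n)(m(k) − m(k(ξ+n)))`, the eigenvalue frequencies of the Bloch
operators of the BBM equation linearized about zero. -/
noncomputable def omegaBBM (k ξ : ℝ) (n : ℤ) : ℝ :=
  (ξ + n) * (mBBM k - mBBM (k * (ξ + n)))

/-- Closed form of `x (m(k) − m(kx))`. -/
lemma mul_mBBM_sub_mBBM (k x : ℝ) :
    x * (mBBM k - mBBM (k * x)) =
      k ^ 2 / (1 + k ^ 2) * (x * (x ^ 2 - 1) / (1 + k ^ 2 * x ^ 2)) := by
  have h₁ : 1 + k ^ 2 ≠ 0 := by positivity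
  have h₂ : 1 + k ^ 2 * x ^ 2 ≠ 0 := by positivity
  unfold mBBM
  rw [mul_pow]
  field_simp
  ring

lemma mul_mBBM_sub_mBBM_pos {k x : ℝ} (hk : 0 < k) (hx : 0 < x * (x ^ 2 - 1)) :
    0 < x * (mBBM k - mBBM (k * x)) := by
  rw [mul_mBBM_sub_mBBM]
  positivity

lemma mul_mBBM_sub_mBBM_neg {k x : ℝ} (hk : 0 < k) (hx : x * (x ^ 2 - 1) < 0) :
    x * (mBBM k - mBBM (k * x)) < 0 := by
  rw [mul_mBBM_sub_mBBM]
  exact mul_neg_of_pos_of_neg (by positivity) (div_neg_of_neg_of_pos hx (by positivity))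

lemma mul_mBBM_sub_mBBM_lt {k x y : ℝ} (hk : 0 < k) (hxy : x < y) (hpos : 0 < x * y)
    (hone : 1 < x ^ 2 + x * y + y ^ 2) :
    x * (mBBM k - mBBM (k * x)) < y * (mBBM k - mBBM (k * y)) := by
  rw [mul_mBBM_sub_mBBM, mul_mBBM_sub_mBBM]
  refine mul_lt_mul_of_pos_left ?_ (by positivity)
  rw [div_lt_div_iff₀ (by positivity) (by positivity), ← sub_pos]
  have hfactor : y * (y ^ 2 - 1) * (1 + k ^ 2 * x ^ 2) - x * (x ^ 2 - 1) * (1 + k ^ 2 * y ^ 2) =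
      (y - x) * ((x ^ 2 + x * y + y ^ 2 - 1) + k ^ 2 * (x * y) * (x * y + 1)) := by ring
  rw [hfactor]
  exact mul_pos (sub_pos.2 hxy) (add_pos (sub_pos.2 hone) (by positivity))

/-- Ordering and signs of the eigenvalue frequencies `ω_{n,ξ}` of the
BBM Bloch operators, for `k > 0` and `0 < ξ ≤ 1/2`. -/
theorem omegaBBM_signs_and_order (k ξ : ℝ) (hk : 0 < k) (hξ0 : 0 < ξ) (hξ : ξ ≤ 1/2) :
    (∀ n : ℤ, 1 ≤ n → 0 < omegaBBM k ξ n) ∧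
    (∀ n : ℤ, n ≤ -2 → omegaBBM k ξ n < 0) ∧
    omegaBBM k ξ 0 < 0 ∧
    0 < omegaBBM k ξ (-1) ∧
    (∀ n : ℤ, (1 ≤ n ∨ n ≤ -3) → omegaBBM k ξ n < omegaBBM k ξ (n + 1)) := by
  unfold omegaBBM
  refine ⟨fun n hn => ?_, fun n hn => ?_, ?_, ?_, fun n hn => ?_⟩
  · have hn' : (1 : ℝ) ≤ n := by exact_mod_cast hn
    exact mul_mBBM_sub_mBBM_pos hk (mul_pos (by linarith) (by nlinarith))
  · have hn' : (n : ℝ) ≤ -2 := by exact_mod_cast hn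
    exact mul_mBBM_sub_mBBM_neg hk (mul_neg_of_neg_of_pos (by linarith) (by nlinarith))
  · refine mul_mBBM_sub_mBBM_neg hk (mul_neg_of_pos_of_neg ?_ ?_) <;> push_cast <;> nlinarith
  · refine mul_mBBM_sub_mBBM_pos hk (mul_pos_of_neg_of_neg ?_ ?_) <;> push_cast <;> nlinarith
  · push_cast
    rcases hn with hn | hn
    · have hn' : (1 : ℝ) ≤ n := by exact_mod_cast hn
      exact mul_mBBM_sub_mBBM_lt hk (by linarith) (mul_pos (by linarith) (by linarith))
        (by nlinarith)
    · have hn' : (n : ℝ) ≤ -3 := by exact_mod_cast hn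
      exact mul_mBBM_sub_mBBM_lt hk (by linarith)
        (mul_pos_of_neg_of_neg (by linarith) (by linarith)) (by nlinarith)
end

section
/- Let m(k) = 1/(1+k²) and, for k > 0, ξ ∈ ℝ and n ∈ ℤ, set ω_{n,ξ} := (ξ+n)·(m(k) − m(k(ξ+n))). If 0 < ξ ≤ 1/2, k > 0, n ≥ 1 is an integer, and ω_{−1,ξ} = ω_{n,ξ}, then n = 1 and k²(1−ξ²) = 3; in particular k ≥ √3. -/
/-- The numbers `x (m(k) − m(kx))` and `y (m(k) − m(ky))` agree at distinct points `x`, `y` only if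
the quotient of their cleared-denominator difference by `x - y` vanishes. -/
lemma mBBM_collision_quotient {k x y : ℝ} (hk : k ≠ 0) (hxy : x ≠ y)
    (h : x * (mBBM k - mBBM (k * x)) = y * (mBBM k - mBBM (k * y))) :
    x^2 + x * y + y^2 - 1 + k^2 * (x * y * (x * y + 1)) = 0 := by
  have h0 : 1 + k^2 ≠ 0 := by positivity
  have hx : 1 + (k * x)^2 ≠ 0 := by positivity
  have hy : 1 + (k * y)^2 ≠ 0 := by positivity
  unfold mBBM at h
  rw [div_sub_div _ _ h0 hx, div_sub_div _ _ h0 hy, mul_div_assoc', mul_div_assoc',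
    div_eq_div_iff (mul_ne_zero h0 hx) (mul_ne_zero h0 hy)] at h
  have hne : (1 + k^2) * k^2 * (x - y) ≠ 0 :=
    mul_ne_zero (mul_ne_zero h0 (pow_ne_zero 2 hk)) (sub_ne_zero.mpr hxy)
  refine (mul_eq_zero.mp ?_).resolve_left hne
  linear_combination h

/-- If `ω_{−1,ξ} = ω_{n,ξ}` for some integer `n ≥ 1`, `k > 0` and
`0 < ξ ≤ 1/2`, then `n = 1` and `k²(1−ξ²) = 3`; in particular `k ≥ √3`. -/
theorem omegaBBM_collision_neg_one (k ξ : ℝ) (n : ℤ) (hk : 0 < k)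
    (hξ0 : 0 < ξ) (hξ : ξ ≤ 1/2) (hn : 1 ≤ n)
    (hcol : omegaBBM k ξ (-1) = omegaBBM k ξ n) :
    n = 1 ∧ k^2 * (1 - ξ^2) = 3 ∧ Real.sqrt 3 ≤ k := by
  have hn' : (1 : ℝ) ≤ n := by exact_mod_cast hn
  have hq := mBBM_collision_quotient (x := ξ + ((-1 : ℤ) : ℝ)) (y := ξ + n) hk.ne'
    (by push_cast; intro h; linarith) hcol
  push_cast at hq
  have hn1 : n = 1 := by
    by_contra hne
    have hn2 : (2 : ℝ) ≤ n := by exact_mod_cast (show (2 : ℤ) ≤ n by omega)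
    have hab : 1 < (1 - ξ) * (ξ + n) := by nlinarith
    have hquad : 0 < (ξ + n)^2 - (1 - ξ) * (ξ + n) + (1 - ξ)^2 - 1 := by nlinarith
    have hprod : 0 < k^2 * ((1 - ξ) * (ξ + n) * ((1 - ξ) * (ξ + n) - 1)) :=
      mul_pos (pow_pos hk 2) (mul_pos (by linarith) (by linarith))
    linarith
  subst hn1
  have hk3 : k^2 * (1 - ξ^2) = 3 := by
    refine mul_left_cancel₀ (pow_ne_zero 2 hξ0.ne') ?_
    push_cast at hq
    linear_combination -hq
  refine ⟨rfl, hk3, Real.sqrt_le_iff.mpr ⟨hk.le, ?_⟩⟩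
  nlinarith [mul_nonneg (sq_nonneg k) (sq_nonneg ξ)]
end

section
/- Let m(k) = 1/(1+k²) and, for k > 0, ξ ∈ ℝ and n ∈ ℤ, set ω_{n,ξ} := (ξ+n)·(m(k) − m(k(ξ+n))). If 0 < ξ ≤ 1/2, k > 0, n ≤ −2 is an integer, and ω_{0,ξ} = ω_{n,ξ}, then k ≥ 2√(3/5). -/
/-- A collision of the frequencies at the wave numbers `a` and `-b` gives, after clearing
denominators, a relation that is linear in `k²`. -/
theorem mBBM_collision_identity {k a b : ℝ} (hk : k ≠ 0) (hab : a + b ≠ 0)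
    (h : a * (mBBM k - mBBM (k * a)) = -b * (mBBM k - mBBM (k * -b))) :
    k ^ 2 * (a * b * (1 - a * b)) = (a + b) ^ 2 - 3 * (a * b) - 1 := by
  have h₁ : 1 + k ^ 2 ≠ 0 := by positivity
  have h₂ : 1 + (k * a) ^ 2 ≠ 0 := by positivity
  have h₃ : 1 + (k * -b) ^ 2 ≠ 0 := by positivity
  unfold mBBM at h
  rw [div_sub_div _ _ h₁ h₂, div_sub_div _ _ h₁ h₃, mul_div_assoc', mul_div_assoc',
    div_eq_div_iff (mul_ne_zero h₁ h₂) (mul_ne_zero h₁ h₃)] at h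
  have hne : k ^ 2 * (a + b) * (1 + k ^ 2) ≠ 0 :=
    mul_ne_zero (mul_ne_zero (pow_ne_zero 2 hk) hab) h₁
  apply mul_left_cancel₀ hne
  linear_combination -h

/-- If `ω_{0,ξ} = ω_{n,ξ}` for some integer `n ≤ −2`, `k > 0` and
`0 < ξ ≤ 1/2`, then `k ≥ 2√(3/5)`. -/
theorem omegaBBM_collision_zero (k ξ : ℝ) (n : ℤ) (hk : 0 < k)
    (hξ0 : 0 < ξ) (hξ : ξ ≤ 1/2) (hn : n ≤ -2)
    (hcol : omegaBBM k ξ 0 = omegaBBM k ξ n) :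
    2 * Real.sqrt (3/5) ≤ k := by
  have hN : (n : ℝ) ≤ -2 := by exact_mod_cast hn
  obtain ⟨b, hb⟩ : ∃ b : ℝ, b = -(ξ + n) := ⟨_, rfl⟩
  have hb' : ξ + n = -b := by linarith
  have hb2 : 2 ≤ ξ + b := by linarith
  simp only [omegaBBM, hb', Int.cast_zero, add_zero] at hcol
  have hid := mBBM_collision_identity hk.ne' (by linarith) hcol
  have hp : 0 < ξ * b := mul_pos hξ0 (by linarith)
  have hp' : ξ * b ≤ (ξ + b) / 2 - 1 / 4 := by nlinarith
  have hlt : ξ * b < 1 := by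
    by_contra! hge
    have : k ^ 2 * (ξ * b * (1 - ξ * b)) ≤ 0 :=
      mul_nonpos_of_nonneg_of_nonpos (sq_nonneg k)
        (mul_nonpos_of_nonneg_of_nonpos hp.le (by linarith))
    nlinarith
  have hkp : 3 ≤ k ^ 2 * (ξ * b) := by
    refine le_of_mul_le_mul_right ?_ (sub_pos.mpr hlt)
    nlinarith
  have hk2 : 3 ≤ k ^ 2 := hkp.trans (mul_le_of_le_one_right (sq_nonneg k) hlt.le)
  refine (abs_le_of_sq_le_sq' ?_ hk.le).2
  rw [mul_pow, Real.sq_sqrt (by norm_num)]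
  linarith
end

section
/- Let m(k) = 1/√(1+k²). For every k > 0, i_Bnesq(k) = 2·(m(k)² − m(2k)²) + m(2k)²·((the derivative at k of the map k ↦ k·m(k))² − 1) is positive. -/
/-- The regularized Boussinesq dispersion symbol `m(k) = 1/√(1+k²)`. -/
noncomputable def mBnesq (k : ℝ) : ℝ := 1 / Real.sqrt (1 + k^2)

/-- `i_Bnesq(k) = 2 i₃⁻(k) i₃⁺(k) + m(2k)² i₂⁻(k) i₂⁺(k)`. -/
noncomputable def iBnesq (k : ℝ) : ℝ :=
  2 * ((mBnesq k)^2 - (mBnesq (2*k))^2)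
    + (mBnesq (2*k))^2 * ((deriv (fun x : ℝ => x * mBnesq x) k)^2 - 1)

/-- The squared symbol is rational. -/
lemma mBnesq_sq (k : ℝ) : mBnesq k ^ 2 = 1 / (1 + k ^ 2) := by
  rw [mBnesq, div_pow, one_pow, Real.sq_sqrt (by positivity)]

/-- The group velocity, the derivative of `k m(k)`, equals `m(k)³`. -/
lemma hasDerivAt_mul_mBnesq (k : ℝ) :
    HasDerivAt (fun x : ℝ => x * mBnesq x) (mBnesq k ^ 3) k := by
  have hpos : 0 < 1 + k ^ 2 := by positivity
  have hsqrt : √(1 + k ^ 2) ≠ 0 := (Real.sqrt_pos.2 hpos).ne'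
  have hsq : √(1 + k ^ 2) ^ 2 = 1 + k ^ 2 := Real.sq_sqrt hpos.le
  have hm : HasDerivAt (fun x : ℝ => x / √(1 + x ^ 2)) _ k :=
    (hasDerivAt_id k).div ((((hasDerivAt_id k).pow 2).const_add 1).sqrt hpos.ne') hsqrt
  convert hm using 1
  · funext x
    simp [mBnesq, div_eq_mul_inv]
  · simp only [mBnesq, id, Nat.cast_ofNat, Nat.add_one_sub_one, pow_one, mul_one, one_mul,
      Pi.pow_apply]
    field_simp
    linarith

/-- For `m(k) = 1/√(1+k²)`, `i_Bnesq(k) > 0` for every `k > 0`. -/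
theorem iBnesq_pos (k : ℝ) (hk : 0 < k) : 0 < iBnesq k := by
  have hsq : (mBnesq k ^ 3) ^ 2 = (1 / (1 + k ^ 2)) ^ 3 := by
    rw [← mBnesq_sq]
    ring
  have key : iBnesq k =
      (3 * k ^ 2 + 9 * k ^ 4 + 5 * k ^ 6) / ((1 + (2 * k) ^ 2) * (1 + k ^ 2) ^ 3) := by
    rw [iBnesq, (hasDerivAt_mul_mBnesq k).deriv, hsq, mBnesq_sq, mBnesq_sq]
    field_simp
    ring
  rw [key]
  positivity
end

section
/- Fix α ≥ 2 and let m(k) = 1 + k^α for k > 0 (real power). Then for every k > 0, i_BBM(k) := 2·(m(k) − m(2k)) + m(2k)·((the derivative at k of the map k ↦ k·m(k)) − 1) equals (3 + α − 2^{1+α})·k^α + 2^α(1+α)·k^{2α}; moreover, setting k_c := ((2^{1+α} − 3 − α)/(2^α(1+α)))^{1/α} > 0, one has i_BBM(k) > 0 if and only if k > k_c. -/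
/-- `i_BBM(k) = 2(m(k) − m(2k)) + m(2k)((k m(k))' − 1)` for `m(k) = 1 + k^α`. -/
noncomputable def iBBMfrac (α k : ℝ) : ℝ :=
  2 * ((1 + k ^ α) - (1 + (2*k) ^ α))
    + (1 + (2*k) ^ α) * (deriv (fun x : ℝ => x * (1 + x ^ α)) k - 1)

theorem iBBMfrac_eq (α k : ℝ) (hk : 0 < k) :
    iBBMfrac α k = (3 + α - (2:ℝ) ^ (1 + α)) * k ^ α + (2:ℝ) ^ α * (1 + α) * k ^ (2*α) := by
  have hderiv : deriv (fun x : ℝ => x * (1 + x ^ α)) k = 1 + (1 + α) * k ^ α := by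
    have h : HasDerivAt (fun x : ℝ => x * (1 + x ^ α))
        (1 * (1 + k ^ α) + k * (α * k ^ (α - 1))) k :=
      (hasDerivAt_id' k).mul ((Real.hasDerivAt_rpow_const (Or.inl hk.ne')).const_add 1)
    rw [h.deriv, Real.rpow_sub_one hk.ne']
    field_simp
    ring
  rw [iBBMfrac, hderiv, Real.mul_rpow zero_le_two hk.le, Real.rpow_add two_pos, Real.rpow_one,
    two_mul α, Real.rpow_add hk]
  ring

theorem three_add_lt_two_rpow_one_add {α : ℝ} (hα : 1 < α) : 3 + α < (2:ℝ) ^ (1 + α) := by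
  have h := one_add_mul_self_le_rpow_one_add (s := 1) (by norm_num) hα.le
  norm_num at h
  rw [Real.rpow_add two_pos, Real.rpow_one]
  linarith

/-- For fractional dispersion `m(k) = 1 + k^α` with `α ≥ 2`,
`i_BBM(k) = (3 + α − 2^{1+α}) k^α + 2^α(1+α) k^{2α}` for every `k > 0`; moreover the
critical wave number `k_c = ((2^{1+α} − 3 − α)/(2^α(1+α)))^{1/α}` is positive and
`i_BBM(k) > 0 ↔ k > k_c`. -/
theorem iBBM_fractional (α : ℝ) (hα : 2 ≤ α) :
    (∀ k : ℝ, 0 < k →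
      iBBMfrac α k = (3 + α - (2:ℝ) ^ (1 + α)) * k ^ α
        + (2:ℝ) ^ α * (1 + α) * k ^ (2*α)) ∧
    0 < (((2:ℝ) ^ (1 + α) - 3 - α) / ((2:ℝ) ^ α * (1 + α))) ^ (1/α) ∧
    (∀ k : ℝ, 0 < k →
      (0 < iBBMfrac α k ↔
        (((2:ℝ) ^ (1 + α) - 3 - α) / ((2:ℝ) ^ α * (1 + α))) ^ (1/α) < k)) := by
  have hα0 : 0 < α := by linarith
  have hden : 0 < (2:ℝ) ^ α * (1 + α) := by positivity
  have hc : 0 < ((2:ℝ) ^ (1 + α) - 3 - α) / ((2:ℝ) ^ α * (1 + α)) :=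
    div_pos (by linarith [three_add_lt_two_rpow_one_add (α := α) (by linarith)]) hden
  refine ⟨iBBMfrac_eq α, Real.rpow_pos_of_pos hc _, fun k hk => ?_⟩
  have hfactor : iBBMfrac α k =
      k ^ α * (k ^ α * ((2:ℝ) ^ α * (1 + α)) - ((2:ℝ) ^ (1 + α) - 3 - α)) := by
    rw [iBBMfrac_eq α k hk, two_mul α, Real.rpow_add hk]
    ring
  rw [hfactor, mul_pos_iff_of_pos_left (Real.rpow_pos_of_pos hk α), sub_pos, ← div_lt_iff₀ hden,
    one_div, Real.rpow_inv_lt_iff_of_pos hc.le hk.le hα0]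
end
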